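/- Let f : [0,∞) → ℝ be continuous and satisfy |f(t)| ≤ M e^{A t} for some constants M, A > 0. Then for every compact set K ⊆ [0,∞), lim_{n→∞} sup_{x ∈ K} | M_n^{(α,β)}[f](x) − f(x) | = 0, the limit being over natural numbers n > β + A. -/

import Mathlib

open MeasureTheory Real Filter

/-- The Szász–Mirakyan basis functions `ψ_{n,k}(x) = e^{-nx} (nx)^k / k!`. -/
noncomputable def psi (n k : ℕ) (x : ℝ) : ℝ :=
  Real.exp (-(n * x)) * (n * x) ^ k / (Nat.factorial k)

/-- The Szász–Mirakyan–Laguerre–Durrmeyer operator `M_n^{(α,β)}`. -/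
noncomputable def M (α β : ℝ) (n : ℕ) (f : ℝ → ℝ) (x : ℝ) : ℝ :=
  ∑' k : ℕ, (((n : ℝ) - β) ^ ((k : ℝ) + α + 1) / Real.Gamma ((k : ℝ) + α + 1)) *
    (∫ t in Set.Ioi (0 : ℝ), f t * t ^ ((k : ℝ) + α) * Real.exp (-((n : ℝ) - β) * t)) *
    psi n k x

/-- The `r`-th moment `μ_r^{(α,β)}(x) = M_n^{(α,β)}[t ↦ t^r](x)`. -/
noncomputable def mu (α β : ℝ) (n : ℕ) (r : ℕ) (x : ℝ) : ℝ :=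
  M α β n (fun t => t ^ r) x

lemma aux_cg {f g : ℕ → ℝ} {a b : ℝ} (h : HasSum f a) (h1 : ∀ k, g k = f k) (h2 : b = a) :
    HasSum g b := by
  rw [h2, funext h1]; exact h

lemma aux_gamma (s d : ℝ) (hs : 0 < s) (hd : 0 < d) :
    IntegrableOn (fun t : ℝ => t ^ (s - 1) * Real.exp (-(d * t))) (Set.Ioi 0) ∧
    ∫ t in Set.Ioi (0 : ℝ), t ^ (s - 1) * Real.exp (-(d * t)) = Real.Gamma s / d ^ s := by
  have h := Real.integral_rpow_mul_exp_neg_mul_Ioi hs hd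
  have h2 : (1 / d) ^ s * Real.Gamma s = Real.Gamma s / d ^ s := by
    rw [Real.div_rpow zero_le_one hd.le, Real.one_rpow]; ring
  rw [h2] at h
  refine ⟨?_, h⟩
  apply Integrable.of_integral_ne_zero
  rw [h]
  have := Real.Gamma_pos_of_pos hs
  positivity

lemma aux_W (s d x : ℝ) (hs : 0 < s) (hd : 0 < d) :
    IntegrableOn (fun t : ℝ => (t - x) ^ 2 * (t ^ (s - 1) * Real.exp (-(d * t)))) (Set.Ioi 0) ∧
    ∫ t in Set.Ioi (0 : ℝ), (t - x) ^ 2 * (t ^ (s - 1) * Real.exp (-(d * t)))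
      = Real.Gamma s / d ^ s * (s * (s + 1) / d ^ 2 - 2 * x * s / d + x ^ 2) := by
  obtain ⟨i0, e0⟩ := aux_gamma s d hs hd
  obtain ⟨i1, e1⟩ := aux_gamma (s + 1) d (by linarith) hd
  obtain ⟨i2, e2⟩ := aux_gamma (s + 1 + 1) d (by linarith) hd
  have key : Set.EqOn (fun t : ℝ => (t ^ (s + 1 + 1 - 1) * Real.exp (-(d * t))
      + (-2 * x) * (t ^ (s + 1 - 1) * Real.exp (-(d * t))))
      + x ^ 2 * (t ^ (s - 1) * Real.exp (-(d * t))))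
      (fun t : ℝ => (t - x) ^ 2 * (t ^ (s - 1) * Real.exp (-(d * t)))) (Set.Ioi 0) := by
    intro t ht
    have ht : 0 < t := ht
    have a1 : t ^ (s + 1 - 1) = t ^ (s - 1) * t := by
      rw [← Real.rpow_add_one ht.ne']; congr 1; ring
    have a2 : t ^ (s + 1 + 1 - 1) = t ^ (s - 1) * t * t := by
      rw [← a1, ← Real.rpow_add_one ht.ne']; congr 1; ring
    simp only [a1, a2]
    ring
  have hi : IntegrableOn (fun t : ℝ => t ^ (s + 1 + 1 - 1) * Real.exp (-(d * t))
      + (-2 * x) * (t ^ (s + 1 - 1) * Real.exp (-(d * t)))) (Set.Ioi 0) :=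
    (i2.add (i1.const_mul (-2 * x)))
  have hi' := hi.add (i0.const_mul (x ^ 2))
  refine ⟨IntegrableOn.congr_fun hi' key measurableSet_Ioi, ?_⟩
  rw [← setIntegral_congr_fun measurableSet_Ioi key]
  rw [integral_add hi (i0.const_mul (x ^ 2)), integral_add i2 (i1.const_mul (-2 * x)),
    integral_const_mul, integral_const_mul, e0, e1, e2]
  rw [Real.Gamma_add_one (by linarith), Real.Gamma_add_one hs.ne',
    Real.rpow_add_one hd.ne', Real.rpow_add_one hd.ne']
  have : d ^ s ≠ 0 := (Real.rpow_pos_of_pos hd s).ne'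
  field_simp
  ring

lemma aux_L (f : ℝ → ℝ) (hf : ContinuousOn f (Set.Ici 0)) (s c A x y ε C : ℝ) (hs : 0 < s)
    (hA : 0 < A) (hd : 0 < c - A)
    (hb : ∀ t, 0 < t → |f t - y| ≤ ε + C * ((t - x) ^ 2 * Real.exp (A * t))) :
    |c ^ s / Real.Gamma s * (∫ t in Set.Ioi (0 : ℝ), f t * t ^ (s - 1) * Real.exp (-c * t)) - y|
      ≤ ε + C * ((c / (c - A)) ^ s *
        (s * (s + 1) / (c - A) ^ 2 - 2 * x * s / (c - A) + x ^ 2)) := by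
  have hc : 0 < c := by linarith
  obtain ⟨i0, e0⟩ := aux_gamma s c hs hc
  obtain ⟨i1, e1⟩ := aux_W s (c - A) x hs hd
  have hG := Real.Gamma_pos_of_pos hs
  have hcs := Real.rpow_pos_of_pos hc s
  have hds := Real.rpow_pos_of_pos hd s
  have hI : Integrable (fun t : ℝ => ε * (t ^ (s - 1) * Real.exp (-(c * t)))
       + C * ((t - x) ^ 2 * (t ^ (s - 1) * Real.exp (-((c - A) * t)))))
       (volume.restrict (Set.Ioi 0)) := (i0.const_mul ε).add (i1.const_mul C)
  have hle : ∀ t ∈ Set.Ioi (0 : ℝ), ‖(f t - y) * (t ^ (s - 1) * Real.exp (-(c * t)))‖ ≤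
      ε * (t ^ (s - 1) * Real.exp (-(c * t)))
       + C * ((t - x) ^ 2 * (t ^ (s - 1) * Real.exp (-((c - A) * t)))) := by
    intro t ht
    have ht : 0 < t := ht
    have hw : 0 < t ^ (s - 1) * Real.exp (-(c * t)) := by positivity
    rw [norm_mul, Real.norm_of_nonneg hw.le, Real.norm_eq_abs]
    calc _ ≤ _ := mul_le_mul_of_nonneg_right (hb t ht) hw.le
      _ = _ := by
        have : Real.exp (-((c - A) * t)) = Real.exp (A * t) * Real.exp (-(c * t)) := by
          rw [← Real.exp_add]; congr 1; ring
        rw [this]; ring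
  have hm : AEStronglyMeasurable (fun t => (f t - y) * (t ^ (s - 1) * Real.exp (-(c * t))))
      (volume.restrict (Set.Ioi 0)) := by
    apply AEStronglyMeasurable.mul
    · exact (((hf.mono Set.Ioi_subset_Ici_self).sub continuousOn_const)).aestronglyMeasurable
        measurableSet_Ioi
    · exact i0.aestronglyMeasurable
  have hae : ∀ᵐ t ∂(volume.restrict (Set.Ioi (0:ℝ))),
      ‖(f t - y) * (t ^ (s - 1) * Real.exp (-(c * t)))‖ ≤
      ε * (t ^ (s - 1) * Real.exp (-(c * t)))
       + C * ((t - x) ^ 2 * (t ^ (s - 1) * Real.exp (-((c - A) * t)))) :=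
    (ae_restrict_iff' measurableSet_Ioi).2 (Eventually.of_forall hle)
  have hg : Integrable (fun t => (f t - y) * (t ^ (s - 1) * Real.exp (-(c * t))))
      (volume.restrict (Set.Ioi 0)) := Integrable.mono' hI hm hae
  have hn := norm_integral_le_of_norm_le hI hae
  rw [integral_add (i0.const_mul ε) (i1.const_mul C), integral_const_mul, integral_const_mul,
    e0, e1, Real.norm_eq_abs] at hn
  have hsplit : ∫ t in Set.Ioi (0 : ℝ), f t * t ^ (s - 1) * Real.exp (-c * t)
      = (∫ t in Set.Ioi (0 : ℝ), (f t - y) * (t ^ (s - 1) * Real.exp (-(c * t))))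
        + y * (Real.Gamma s / c ^ s) := by
    rw [← e0, ← integral_const_mul, ← integral_add hg (i0.const_mul y)]
    congr 1; ext t; rw [neg_mul]; ring
  rw [hsplit]
  have h1 : c ^ s / Real.Gamma s * ((∫ t in Set.Ioi (0 : ℝ),
      (f t - y) * (t ^ (s - 1) * Real.exp (-(c * t)))) + y * (Real.Gamma s / c ^ s)) - y
      = c ^ s / Real.Gamma s * (∫ t in Set.Ioi (0 : ℝ),
      (f t - y) * (t ^ (s - 1) * Real.exp (-(c * t)))) := by
    field_simp; ring
  rw [h1, abs_mul, abs_of_pos (by positivity)]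
  calc _ ≤ _ := mul_le_mul_of_nonneg_left hn (by positivity)
    _ = _ := by
      rw [Real.div_rpow hc.le hd.le]; field_simp

lemma aux_pois (y : ℝ) : HasSum (fun k : ℕ => y ^ k / (Nat.factorial k)) (Real.exp y) := by
  rw [Real.exp_eq_exp_ℝ]; exact NormedSpace.expSeries_div_hasSum_exp y

lemma aux_pois1 (y : ℝ) :
    HasSum (fun k : ℕ => (k : ℝ) * (y ^ k / (Nat.factorial k))) (y * Real.exp y) := by
  rw [← hasSum_nat_add_iff' 1]
  simp only [Finset.sum_range_one, Nat.cast_zero, zero_mul, sub_zero]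
  refine aux_cg ((aux_pois y).mul_left y) (fun k => ?_) rfl
  rw [Nat.factorial_succ]
  push_cast
  have : (k : ℝ) + 1 ≠ 0 := by positivity
  field_simp
  ring

lemma aux_pois2 (y : ℝ) :
    HasSum (fun k : ℕ => (k : ℝ) * k * (y ^ k / (Nat.factorial k)))
      ((y ^ 2 + y) * Real.exp y) := by
  rw [← hasSum_nat_add_iff' 1]
  simp only [Finset.sum_range_one, Nat.cast_zero, zero_mul, sub_zero]
  refine aux_cg (((aux_pois1 y).add (aux_pois y)).mul_left y) (fun k => ?_) ?_
  · rw [Nat.factorial_succ]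
    push_cast
    have : (k : ℝ) + 1 ≠ 0 := by positivity
    field_simp
    ring
  · ring

lemma aux_psi (n : ℕ) (x : ℝ) : HasSum (fun k => psi n k x) 1 := by
  have := (aux_pois (n * x)).mul_left (Real.exp (-(n * x)))
  rw [← Real.exp_add, neg_add_cancel, Real.exp_zero] at this
  refine aux_cg this (fun k => ?_) rfl
  unfold psi; ring

lemma aux_P (n : ℕ) (x p r d : ℝ) (hr : 0 < r) :
    HasSum (fun k : ℕ => (r ^ ((k : ℝ) + p) * (((k : ℝ) + p) * ((k : ℝ) + p + 1) / d ^ 2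
      - 2 * x * ((k : ℝ) + p) / d + x ^ 2)) * psi n k x)
      (r ^ p * Real.exp (n * x * (r - 1)) *
        (((n * x * r + p) / d - x) ^ 2 + (2 * (n * x * r) + p) / d ^ 2)) := by
  set y := n * x * r with hy
  have h := ((((aux_pois2 y).mul_left (1 / d ^ 2)).add
    ((aux_pois1 y).mul_left ((2 * p + 1) / d ^ 2 - 2 * x / d))).add
    ((aux_pois y).mul_left (p * (p + 1) / d ^ 2 - 2 * x * p / d + x ^ 2))).mul_left
    (r ^ p * Real.exp (-(n * x)))
  refine aux_cg h (fun k => ?_) ?_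
  · unfold psi
    rw [Real.rpow_add hr, Real.rpow_natCast, hy, mul_pow (n * x) r]
    ring
  · have : Real.exp (n * x * (r - 1)) = Real.exp (-(n * x)) * Real.exp y := by
      rw [← Real.exp_add, hy]; congr 1; ring
    rw [this]; ring

lemma aux_pt (f : ℝ → ℝ) (hf : ContinuousOn f (Set.Ici 0)) (Mc A : ℝ) (hMc : 0 < Mc) (hA : 0 < A)
    (hbound : ∀ t : ℝ, 0 ≤ t → |f t| ≤ Mc * Real.exp (A * t)) (b ε : ℝ) (hε : 0 < ε) :
    ∃ C : ℝ, 0 < C ∧ ∀ x, 0 ≤ x → x ≤ b → ∀ t, 0 < t →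
      |f t - f x| ≤ ε + C * ((t - x) ^ 2 * Real.exp (A * t)) := by
  have huc : UniformContinuousOn f (Set.Icc 0 (b + 1)) :=
    isCompact_Icc.uniformContinuousOn_of_continuous (hf.mono Set.Icc_subset_Ici_self)
  rw [Metric.uniformContinuousOn_iff] at huc
  obtain ⟨δ, hδ, H⟩ := huc ε hε
  set η := min δ 1 with hη
  have hη0 : 0 < η := lt_min hδ one_pos
  refine ⟨Mc * (1 + Real.exp (A * b)) / η ^ 2, by positivity, ?_⟩
  intro x hx0 hxb t ht
  by_cases hc : |t - x| < η
  · have h1 : |f t - f x| < ε := by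
      have := H t ⟨ht.le, by
        have := lt_of_lt_of_le hc (min_le_right _ _)
        rw [abs_lt] at this; linarith⟩ x ⟨hx0, by linarith⟩
        (by rw [Real.dist_eq]; exact lt_of_lt_of_le hc (min_le_left _ _))
      rwa [Real.dist_eq] at this
    have : 0 ≤ Mc * (1 + Real.exp (A * b)) / η ^ 2 * ((t - x) ^ 2 * Real.exp (A * t)) := by
      positivity
    linarith
  · push Not at hc
    have h2 : η ^ 2 ≤ (t - x) ^ 2 := by
      rw [← sq_abs (t - x)]; gcongr
    have h3 : |f t - f x| ≤ Mc * Real.exp (A * t) + Mc * Real.exp (A * b) := by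
      have h4 : |f x| ≤ Mc * Real.exp (A * b) := (hbound x hx0).trans (by gcongr)
      exact (abs_sub _ _).trans (add_le_add (hbound t ht.le) h4)
    have h5 : 1 ≤ Real.exp (A * t) := Real.one_le_exp (by positivity)
    have h6 : Mc * Real.exp (A * t) + Mc * Real.exp (A * b)
        ≤ Mc * (1 + Real.exp (A * b)) * Real.exp (A * t) := by
      have : 0 ≤ Mc * Real.exp (A * b) * (Real.exp (A * t) - 1) :=
        mul_nonneg (by positivity) (by linarith)
      nlinarith
    have h7 : Mc * (1 + Real.exp (A * b)) * Real.exp (A * t) ≤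
        Mc * (1 + Real.exp (A * b)) / η ^ 2 * ((t - x) ^ 2 * Real.exp (A * t)) := by
      rw [div_mul_eq_mul_div, le_div_iff₀ (by positivity)]
      have : 0 ≤ Mc * (1 + Real.exp (A * b)) * Real.exp (A * t) := by positivity
      nlinarith
    linarith

/-- Uniform convergence on compact subsets of `[0,∞)` for continuous functions of
exponential growth. -/
theorem stmt_14 (α β : ℝ) (hα : -1 < α) (f : ℝ → ℝ) (hf : ContinuousOn f (Set.Ici 0))
    (Mc A : ℝ) (hMc : 0 < Mc) (hA : 0 < A)
    (hbound : ∀ t : ℝ, 0 ≤ t → |f t| ≤ Mc * Real.exp (A * t))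
    (K : Set ℝ) (hK : IsCompact K) (hKsub : K ⊆ Set.Ici 0) :
    ∀ ε > (0 : ℝ), ∃ N : ℕ, ∀ n : ℕ, N ≤ n → β + A < n →
      ∀ x ∈ K, |M α β n f x - f x| ≤ ε := by
  intro ε hε
  obtain ⟨b0, hb0⟩ := hK.bddAbove
  set b := max b0 0 with hbdef
  have hb : 0 ≤ b := le_max_right _ _
  obtain ⟨C, hC, hpt⟩ := aux_pt f hf Mc A hMc hA hbound b (ε / 2) (by positivity)
  set p := α + 1 with hp
  have hp0 : 0 < p := by linarith
  let F : ℝ → ℝ := fun u => C * ((1 + A * u) ^ p * Real.exp (b * (A * (1 + (β + A) * u))) *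
    ((b * |(1 + (β + A) * u) * (1 + A * u) - 1| + p * u) ^ 2
      + (2 * (b * ((1 + (β + A) * u) * (1 + A * u))) + p * u) * u))
  have hF : ContinuousAt F 0 := by
    have h1 : ContinuousAt (fun u : ℝ => (1 + A * u) ^ p) 0 :=
      ContinuousAt.rpow_const (by fun_prop) (Or.inl (by simp))
    exact continuousAt_const.mul ((h1.mul (by fun_prop)).mul (by fun_prop))
  have hF0 : F 0 = 0 := by simp [F]
  have hu : Tendsto (fun n : ℕ => ((n : ℝ) - β - A)⁻¹) atTop (nhds 0) := by
    apply tendsto_inv_atTop_zero.comp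
    have := tendsto_atTop_add_const_right atTop (-β - A) (tendsto_natCast_atTop_atTop (R := ℝ))
    refine this.congr (fun n => by ring)
  have hlim : Tendsto (fun n : ℕ => F (((n : ℝ) - β - A)⁻¹)) atTop (nhds 0) := by
    have := hF.tendsto.comp hu
    rwa [hF0] at this
  obtain ⟨N, hN⟩ := eventually_atTop.1 (hlim.eventually (gt_mem_nhds (half_pos hε)))
  refine ⟨N, fun n hn hnA x hx => ?_⟩
  have hFn := hN n hn
  have hx0 : 0 ≤ x := hKsub hx
  have hxb : x ≤ b := (hb0 hx).trans (le_max_left _ _)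
  set c : ℝ := (n : ℝ) - β with hc
  have hd : 0 < c - A := by linarith
  have hcpos : 0 < c := by linarith
  have hP := aux_P n x p (c / (c - A)) (c - A) (by positivity)
  have hψ := aux_psi n x
  have hψ0 : ∀ k, 0 ≤ psi n k x := fun k => by unfold psi; positivity
  set a : ℕ → ℝ := fun k => (c ^ ((k : ℝ) + α + 1) / Real.Gamma ((k : ℝ) + α + 1)) *
    (∫ t in Set.Ioi (0 : ℝ), f t * t ^ ((k : ℝ) + α) * Real.exp (-c * t)) with ha
  have hL : ∀ k, |a k - f x| ≤ ε / 2 + C * ((c / (c - A)) ^ ((k : ℝ) + p) *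
      (((k : ℝ) + p) * ((k : ℝ) + p + 1) / (c - A) ^ 2
      - 2 * x * ((k : ℝ) + p) / (c - A) + x ^ 2)) := by
    intro k
    have := aux_L f hf ((k : ℝ) + p) c A x (f x) (ε / 2) C (by positivity) hA hd
      (hpt x hx0 hxb)
    have e1 : (k : ℝ) + p - 1 = k + α := by rw [hp]; ring
    have e2 : (k : ℝ) + p = k + α + 1 := by rw [hp]; ring
    rw [e1] at this
    simp only [ha]
    rw [← e2]
    exact this
  have hsumB := (hψ.mul_left (ε / 2)).add (hP.mul_left C)
  have hterm : ∀ k, ‖(a k - f x) * psi n k x‖ ≤ ε / 2 * psi n k x +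
      C * (((c / (c - A)) ^ ((k : ℝ) + p) * (((k : ℝ) + p) * ((k : ℝ) + p + 1) / (c - A) ^ 2
      - 2 * x * ((k : ℝ) + p) / (c - A) + x ^ 2)) * psi n k x) := by
    intro k
    rw [norm_mul, Real.norm_of_nonneg (hψ0 k), Real.norm_eq_abs]
    calc _ ≤ _ := mul_le_mul_of_nonneg_right (hL k) (hψ0 k)
      _ = _ := by ring
  have hsm : Summable (fun k => (a k - f x) * psi n k x) :=
    Summable.of_norm_bounded hsumB.summable hterm
  have hM : M α β n f x - f x = ∑' k, (a k - f x) * psi n k x := by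
    have h1 := hsm.hasSum.add (hψ.mul_left (f x))
    have h2 : M α β n f x = ∑' k, (a k - f x) * psi n k x + f x * 1 := by
      rw [← h1.tsum_eq]
      unfold M
      congr 1; ext k; simp only [ha]; ring
    rw [h2]; ring
  have hfin := tsum_of_norm_bounded hsumB hterm
  rw [← hM, Real.norm_eq_abs] at hfin
  refine hfin.trans ?_
  suffices hS : C * ((c / (c - A)) ^ p * Real.exp (n * x * (c / (c - A) - 1)) *
        (((n * x * (c / (c - A)) + p) / (c - A) - x) ^ 2
          + (2 * (n * x * (c / (c - A))) + p) / (c - A) ^ 2)) ≤ F ((c - A)⁻¹) by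
    linarith
  set d := c - A with hdd
  have r1 : c / d = 1 + A * d⁻¹ := by
    rw [show c = d + A by rw [hdd]; ring]; field_simp
  have r2 : (n : ℝ) * d⁻¹ = 1 + (β + A) * d⁻¹ := by
    rw [show (n : ℝ) = d + (β + A) by rw [hdd, hc]; ring]; field_simp
  have hu0 : 0 < d⁻¹ := inv_pos.2 hd
  simp only [F]
  rw [← r1, ← r2]
  have hn0 : (0 : ℝ) ≤ n := Nat.cast_nonneg n
  have q1 : (n : ℝ) * x * (c / d - 1) ≤ b * (A * (n * d⁻¹)) := by
    have : (n : ℝ) * x * (c / d - 1) = x * (A * (n * d⁻¹)) := by rw [r1]; ring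
    rw [this]; gcongr
  have q2 : ((n * x * (c / d) + p) / d - x) ^ 2 ≤
      (b * |n * d⁻¹ * (c / d) - 1| + p * d⁻¹) ^ 2 := by
    have : (n * x * (c / d) + p) / d - x = x * (n * d⁻¹ * (c / d) - 1) + p * d⁻¹ := by
      field_simp; ring
    rw [this]
    apply sq_le_sq'
    · have h1 : -(x * |n * d⁻¹ * (c / d) - 1|) ≤ x * (n * d⁻¹ * (c / d) - 1) := by
        have := mul_le_mul_of_nonneg_left (neg_abs_le (n * d⁻¹ * (c / d) - 1)) hx0
        linarith
      have h2 : x * |n * d⁻¹ * (c / d) - 1| ≤ b * |n * d⁻¹ * (c / d) - 1| := by gcongr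
      have h3 : 0 < p * d⁻¹ := by positivity
      linarith
    · have h1 := mul_le_mul_of_nonneg_left (le_abs_self (n * d⁻¹ * (c / d) - 1)) hx0
      have h2 : x * |n * d⁻¹ * (c / d) - 1| ≤ b * |n * d⁻¹ * (c / d) - 1| := by gcongr
      linarith
  have q3 : (2 * (n * x * (c / d)) + p) / d ^ 2 ≤
      (2 * (b * (n * d⁻¹ * (c / d))) + p * d⁻¹) * d⁻¹ := by
    have : (2 * (n * x * (c / d)) + p) / d ^ 2 =
      (2 * (x * (n * d⁻¹ * (c / d))) + p * d⁻¹) * d⁻¹ := by field_simp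
    rw [this]; gcongr
  have q4 : 0 ≤ (2 * (n * x * (c / d)) + p) / d ^ 2 := by positivity
  gcongr
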